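/- arXiv:1603.01720 — 2 statements merged into one kernel-verified Lean document; each statement's English description precedes it below -/
import Mathlib

section
/- Let a, b be real numbers with a > -1, -1 < b < 0 and |b| < 1 + a. Then there exists a constant C > 0, depending only on a and b, such that for all t > s > r > 0: |R_{a,b}(s,t) - R_{a,b}(s,r)| ≤ C · (t-r)^{1+b} · s^a. (The quantity inside the absolute value equals E[B^{a,b}_s (B^{a,b}_t - B^{a,b}_r)].) -/
open Real MeasureTheory

/-- The Euler Beta function. -/
noncomputable def Beta (x y : ℝ) : ℝ := Real.Gamma x * Real.Gamma y / Real.Gamma (x + y)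

/-- The covariance function `R_{a,b}(t,s)` of the weighted fractional Brownian motion. -/
noncomputable def R (a b t s : ℝ) : ℝ :=
  (1 / (2 * Beta (a + 1) (b + 1))) *
    ∫ u in (0:ℝ)..(min t s), u ^ a * ((t - u) ^ b + (s - u) ^ b)

theorem rpow_sub_rpow_add_le {b x d : ℝ} (hb0 : -1 < b) (hb1 : b < 0) (hx : 0 < x) (hd : 0 < d) :
    x ^ b - (x + d) ^ b ≤ d ^ (1 + b) / x := by
  have hxd : 0 < x + d := by linarith
  have hle : x / (x + d) ≤ (x / (x + d)) ^ (-b) := by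
    have := rpow_le_rpow_of_exponent_ge (div_pos hx hxd)
      ((div_le_one hxd).2 (by linarith)) (show -b ≤ 1 by linarith)
    simpa using this
  have hsmall : d / (x + d) ≤ (d / (x + d)) ^ (1 + b) := by
    have := rpow_le_rpow_of_exponent_ge (div_pos hd hxd)
      ((div_le_one hxd).2 (by linarith)) (show 1 + b ≤ 1 by linarith)
    simpa using this
  have hden : (d / (x + d)) ^ (1 + b) ≤ (d / x) ^ (1 + b) :=
    rpow_le_rpow (by positivity) (by gcongr; linarith) (by linarith)
  have hxb : 0 < x ^ b := rpow_pos_of_pos hx b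
  have hquot : x ^ b * (x / (x + d)) ^ (-b) = (x + d) ^ b := by
    rw [div_rpow hx.le hxd.le, rpow_neg hx.le, rpow_neg hxd.le]
    have := (rpow_pos_of_pos hxd b).ne'
    field_simp
  have hfrac : 1 - x / (x + d) = d / (x + d) := by field_simp; ring
  calc x ^ b - (x + d) ^ b = x ^ b * (1 - (x / (x + d)) ^ (-b)) := by rw [mul_sub, hquot, mul_one]
    _ ≤ x ^ b * (d / x) ^ (1 + b) := by gcongr; linarith
    _ = d ^ (1 + b) / x := by
      rw [div_rpow hd.le hx.le, rpow_add hx, rpow_one]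
      field_simp

theorem intervalIntegrable_sub_rpow {b : ℝ} (hb : -1 < b) (x p q : ℝ) :
    IntervalIntegrable (fun u : ℝ => (x - u) ^ b) volume p q := by
  have h := (intervalIntegral.intervalIntegrable_rpow' (a := x - p) (b := x - q) hb).comp_sub_left x
  simpa using h

theorem integral_sub_rpow {b : ℝ} (hb : -1 < b) (x p q : ℝ) :
    ∫ u in p..q, (x - u) ^ b = ((x - p) ^ (b + 1) - (x - q) ^ (b + 1)) / (b + 1) := by
  rw [intervalIntegral.integral_comp_sub_left (fun u : ℝ => u ^ b) x, integral_rpow (Or.inl hb)]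

theorem intervalIntegrable_rpow_mul_sub_rpow {a b x : ℝ} (ha : -1 < a) (hb : -1 < b)
    (hx : 0 < x) : IntervalIntegrable (fun u : ℝ => u ^ a * (x - u) ^ b) volume 0 x := by
  have h1 : IntervalIntegrable (fun u : ℝ => u ^ a * (x - u) ^ b) volume 0 (x / 2) := by
    refine (intervalIntegral.intervalIntegrable_rpow' ha).mul_continuousOn ?_
    refine ContinuousOn.rpow_const (by fun_prop) fun u hu => Or.inl ?_
    rw [Set.uIcc_of_le (by linarith)] at hu
    linarith [hu.2]
  refine h1.trans ((intervalIntegrable_sub_rpow hb x _ _).continuousOn_mul ?_)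
  refine ContinuousOn.rpow_const (by fun_prop) fun u hu => Or.inl ?_
  rw [Set.uIcc_of_le (by linarith)] at hu
  linarith [hu.1]

theorem intervalIntegrable_rpow_mul_sub_rpow_of_mem {a b x p q : ℝ} (ha : -1 < a) (hb : -1 < b)
    (hp : 0 ≤ p) (hpq : p ≤ q) (hqx : q ≤ x) (hx : 0 < x) :
    IntervalIntegrable (fun u : ℝ => u ^ a * (x - u) ^ b) volume p q := by
  refine (intervalIntegrable_rpow_mul_sub_rpow ha hb hx).mono_set ?_
  rw [Set.uIcc_of_le hpq, Set.uIcc_of_le hx.le]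
  exact Set.Icc_subset_Icc hp hqx

theorem integral_rpow_mul_sub_rpow (a b : ℝ) {x : ℝ} (hx : 0 < x) :
    ∫ u in (0:ℝ)..x, u ^ a * (x - u) ^ b
      = (∫ u in (0:ℝ)..1, u ^ a * (1 - u) ^ b) * x ^ (1 + b) * x ^ a := by
  have h := intervalIntegral.mul_integral_comp_mul_left (a := 0) (b := 1)
    (f := fun u : ℝ => u ^ a * (x - u) ^ b) x
  simp only [mul_zero, mul_one] at h
  have hcongr : ∫ v in (0:ℝ)..1, (x * v) ^ a * (x - x * v) ^ b
      = ∫ v in (0:ℝ)..1, (x ^ a * x ^ b) * (v ^ a * (1 - v) ^ b) := by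
    refine intervalIntegral.integral_congr fun v hv => ?_
    rw [Set.uIcc_of_le zero_le_one] at hv
    have e : x - x * v = x * (1 - v) := by ring
    simp only [e]
    rw [mul_rpow hx.le hv.1, mul_rpow hx.le (by linarith [hv.2])]
    ring
  rw [← h, hcongr, intervalIntegral.integral_const_mul, rpow_add hx, rpow_one]
  ring

/-- Splitting of the covariance increment into three nonnegative integrals. -/
theorem R_sub_R_eq {a b r s t : ℝ} (ha : -1 < a) (hb0 : -1 < b) (hr : 0 < r) (hrs : r < s)
    (hst : s < t) :
    R a b s t - R a b s r = (1 / (2 * Beta (a + 1) (b + 1))) *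
      ((∫ u in r..s, u ^ a * (s - u) ^ b) + (∫ u in r..s, u ^ a * (t - u) ^ b)
        - ∫ u in (0:ℝ)..r, u ^ a * ((r - u) ^ b - (t - u) ^ b)) := by
  have hs : 0 < s := hr.trans hrs
  have ht : 0 < t := hs.trans hst
  have hs0 := intervalIntegrable_rpow_mul_sub_rpow_of_mem ha hb0 le_rfl hr.le hrs.le hs
  have hs1 := intervalIntegrable_rpow_mul_sub_rpow_of_mem ha hb0 hr.le hrs.le le_rfl hs
  have ht0 := intervalIntegrable_rpow_mul_sub_rpow_of_mem ha hb0 le_rfl hr.le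
    (hrs.trans hst).le ht
  have ht1 := intervalIntegrable_rpow_mul_sub_rpow_of_mem ha hb0 hr.le hrs.le hst.le ht
  have hr0 := intervalIntegrable_rpow_mul_sub_rpow_of_mem ha hb0 le_rfl hr.le le_rfl hr
  unfold R
  rw [min_eq_left hst.le, min_eq_right hrs.le, ← mul_sub]
  simp only [mul_add, mul_sub]
  rw [intervalIntegral.integral_add (hs0.trans hs1) (ht0.trans ht1),
    intervalIntegral.integral_add hs0 hr0, intervalIntegral.integral_sub hr0 ht0,
    ← intervalIntegral.integral_add_adjacent_intervals hs0 hs1,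
    ← intervalIntegral.integral_add_adjacent_intervals ht0 ht1]
  ring

theorem sub_rpow_le_sub_rpow {b u x y : ℝ} (hb : b < 0) (hu : u < x) (hxy : x ≤ y) :
    (y - u) ^ b ≤ (x - u) ^ b :=
  rpow_le_rpow_of_nonpos (by linarith) (by linarith) hb.le

theorem rpow_le_of_quarter_le {a u s : ℝ} (hs : 0 < s) (hu : s / 4 ≤ u) (hus : u ≤ s) :
    u ^ a ≤ (1 + (1 / 4) ^ a) * s ^ a := by
  have h4 : 0 < (1 / 4 : ℝ) ^ a := by positivity
  have hsa : 0 < s ^ a := rpow_pos_of_pos hs a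
  have hu0 : 0 < u := by linarith
  rcases le_total 0 a with h | h
  · have := rpow_le_rpow hu0.le hus h
    nlinarith
  · have := rpow_le_rpow_of_nonpos (by positivity) (show 1 / 4 * s ≤ u by linarith) h
    rw [mul_rpow (by norm_num) hs.le] at this
    nlinarith

theorem integral_rpow_mul_sub_rpow_le {a b p q s : ℝ} (ha : -1 < a) (hb : -1 < b) (hs : 0 < s)
    (hp : s / 4 ≤ p) (hpq : p ≤ q) (hqs : q ≤ s) :
    ∫ u in p..q, u ^ a * (q - u) ^ b
      ≤ (1 + (1 / 4) ^ a) / (1 + b) * (q - p) ^ (1 + b) * s ^ a := by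
  have hq : 0 < q := by linarith
  have h : ∫ u in p..q, u ^ a * (q - u) ^ b
      ≤ ∫ u in p..q, (1 + (1 / 4) ^ a) * s ^ a * (q - u) ^ b := by
    refine intervalIntegral.integral_mono_on hpq
      (intervalIntegrable_rpow_mul_sub_rpow_of_mem ha hb (by linarith) hpq le_rfl hq)
      ((intervalIntegrable_sub_rpow hb q _ _).const_mul _) fun u hu => ?_
    exact mul_le_mul_of_nonneg_right
      (rpow_le_of_quarter_le hs (hp.trans hu.1) (hu.2.trans hqs))
      (rpow_nonneg (by linarith [hu.2]) b)
  refine h.trans_eq ?_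
  rw [intervalIntegral.integral_const_mul, integral_sub_rpow hb, sub_self,
    zero_rpow (by linarith), add_comm b 1]
  ring

theorem integral_rpow_mul_sub_rpow_sub_le {a b r s t : ℝ} (ha : -1 < a) (hb0 : -1 < b)
    (hb1 : b < 0) (hr : 0 < r) (hsr : s ≤ 2 * r) (hrs : r < s) (hst : s < t) :
    ∫ u in (0:ℝ)..r, u ^ a * ((r - u) ^ b - (t - u) ^ b)
      ≤ ((1 + (1 / 4) ^ a) / (1 + b) + 2 * (1 + (1 / 4) ^ a) / (1 + a))
        * (t - r) ^ (1 + b) * s ^ a := by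
  have hs : 0 < s := hr.trans hrs
  have ht : 0 < t := hs.trans hst
  have hd : 0 < t - r := by linarith
  have hrt : r ≤ t := by linarith
  have hint : ∀ p q : ℝ, 0 ≤ p → p ≤ q → q ≤ r → IntervalIntegrable
      (fun u : ℝ => u ^ a * ((r - u) ^ b - (t - u) ^ b)) volume p q := fun p q hp hpq hq => by
    simp only [mul_sub]
    exact (intervalIntegrable_rpow_mul_sub_rpow_of_mem ha hb0 hp hpq hq hr).sub
      (intervalIntegrable_rpow_mul_sub_rpow_of_mem ha hb0 hp hpq (hq.trans hrt) ht)
  have hnear : ∫ u in (r / 2)..r, u ^ a * ((r - u) ^ b - (t - u) ^ b)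
      ≤ (1 + (1 / 4) ^ a) / (1 + b) * (t - r) ^ (1 + b) * s ^ a := by
    have h1 : ∫ u in (r / 2)..r, u ^ a * ((r - u) ^ b - (t - u) ^ b)
        ≤ ∫ u in (r / 2)..r, (1 + (1 / 4) ^ a) * s ^ a * ((r - u) ^ b - (t - u) ^ b) := by
      refine intervalIntegral.integral_mono_on_of_le_Ioo (by linarith)
        (hint _ _ (by linarith) (by linarith) le_rfl)
        (((intervalIntegrable_sub_rpow hb0 r _ _).sub
          (intervalIntegrable_sub_rpow hb0 t _ _)).const_mul _) fun u hu => ?_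
      exact mul_le_mul_of_nonneg_right
        (rpow_le_of_quarter_le hs (by linarith [hu.1]) (by linarith [hu.2]))
        (sub_nonneg.2 (sub_rpow_le_sub_rpow hb1 hu.2 hrt))
    refine h1.trans ?_
    rw [intervalIntegral.integral_const_mul, intervalIntegral.integral_sub
      (intervalIntegrable_sub_rpow hb0 r _ _) (intervalIntegrable_sub_rpow hb0 t _ _),
      integral_sub_rpow hb0, integral_sub_rpow hb0, sub_self, zero_rpow (by linarith),
      add_comm b 1]
    have hmono : (r - r / 2) ^ (1 + b) ≤ (t - r / 2) ^ (1 + b) :=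
      rpow_le_rpow (by linarith) (by linarith) (by linarith)
    have hb' : 0 < 1 + b := by linarith
    calc (1 + (1 / 4) ^ a) * s ^ a * (((r - r / 2) ^ (1 + b) - 0) / (1 + b)
          - ((t - r / 2) ^ (1 + b) - (t - r) ^ (1 + b)) / (1 + b))
        = (1 + (1 / 4) ^ a) * s ^ a * (((r - r / 2) ^ (1 + b) - (t - r / 2) ^ (1 + b)
          + (t - r) ^ (1 + b)) / (1 + b)) := by ring
      _ ≤ (1 + (1 / 4) ^ a) * s ^ a * ((t - r) ^ (1 + b) / (1 + b)) := by
        gcongr; linarith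
      _ = _ := by ring
  have hfar : ∫ u in (0:ℝ)..(r / 2), u ^ a * ((r - u) ^ b - (t - u) ^ b)
      ≤ 2 * (1 + (1 / 4) ^ a) / (1 + a) * (t - r) ^ (1 + b) * s ^ a := by
    have h1 : ∫ u in (0:ℝ)..(r / 2), u ^ a * ((r - u) ^ b - (t - u) ^ b)
        ≤ ∫ u in (0:ℝ)..(r / 2), u ^ a * ((t - r) ^ (1 + b) / (r / 2)) := by
      refine intervalIntegral.integral_mono_on (by linarith)
        (hint _ _ le_rfl (by linarith) (by linarith))
        ((intervalIntegral.intervalIntegrable_rpow' ha).mul_const _) fun u hu => ?_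
      refine mul_le_mul_of_nonneg_left ?_ (rpow_nonneg hu.1 a)
      have h := rpow_sub_rpow_add_le hb0 hb1 (show 0 < r - u by linarith [hu.2]) hd
      rw [show r - u + (t - r) = t - u by ring] at h
      refine h.trans ?_
      gcongr
      linarith [hu.2]
    refine h1.trans ?_
    have ha' : 0 < 1 + a := by linarith
    have hw : (r / 2) ^ a ≤ (1 + (1 / 4) ^ a) * s ^ a :=
      rpow_le_of_quarter_le hs (by linarith) (by linarith)
    rw [intervalIntegral.integral_mul_const, integral_rpow (Or.inl ha), zero_rpow (by linarith),
      rpow_add (by positivity), rpow_one]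
    calc ((r / 2) ^ a * (r / 2) - 0) / (a + 1) * ((t - r) ^ (1 + b) / (r / 2))
        = (r / 2) ^ a * ((t - r) ^ (1 + b) / (1 + a)) := by
          rw [add_comm a 1]; field_simp; ring
      _ ≤ (1 + (1 / 4) ^ a) * s ^ a * ((t - r) ^ (1 + b) / (1 + a)) := by gcongr
      _ ≤ 2 * ((1 + (1 / 4) ^ a) * s ^ a * ((t - r) ^ (1 + b) / (1 + a))) := by
        have : 0 ≤ (1 + (1 / 4) ^ a) * s ^ a * ((t - r) ^ (1 + b) / (1 + a)) := by positivity
        linarith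
      _ = _ := by ring
  rw [← intervalIntegral.integral_add_adjacent_intervals
    (hint 0 (r / 2) le_rfl (by linarith) (by linarith))
    (hint (r / 2) r (by linarith) (by linarith) le_rfl)]
  linarith

theorem stmt_9 (a b : ℝ) (ha : -1 < a) (hb0 : -1 < b) (hb1 : b < 0) (hb2 : |b| < 1 + a) :
    ∃ C > (0:ℝ), ∀ t s r : ℝ, 0 < r → r < s → s < t →
      |R a b s t - R a b s r| ≤ C * (t - r) ^ (1 + b) * s ^ a := by
  set c := 1 / (2 * Beta (a + 1) (b + 1)) with hc
  set K : ℝ := 1 + (1 / 4) ^ a with hK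
  set B : ℝ := ∫ u in (0:ℝ)..1, u ^ a * (1 - u) ^ b with hB
  have hK0 : 0 < K := by positivity
  have hB0 : 0 ≤ B := intervalIntegral.integral_nonneg zero_le_one fun u hu =>
    mul_nonneg (rpow_nonneg hu.1 a) (rpow_nonneg (by linarith [hu.2]) b)
  have ha' : 0 < 1 + a := by linarith
  have hb' : 0 < 1 + b := by linarith
  set L : ℝ := 3 * B * 2 ^ (1 + b) + (3 * (K / (1 + b)) + 2 * K / (1 + a)) with hL
  have hL0 : 0 < L := by positivity
  refine ⟨|c| * L + 1, by positivity, fun t s r hr hrs hst => ?_⟩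
  have hs : 0 < s := hr.trans hrs
  have ht : 0 < t := hs.trans hst
  have hd : 0 < t - r := by linarith
  have hE : 0 < (t - r) ^ (1 + b) * s ^ a := by positivity
  have hintP := intervalIntegrable_rpow_mul_sub_rpow_of_mem ha hb0 hr.le hrs.le le_rfl hs
  have hQ0 : 0 ≤ ∫ u in r..s, u ^ a * (t - u) ^ b :=
    intervalIntegral.integral_nonneg hrs.le fun u hu =>
      mul_nonneg (rpow_nonneg (by linarith [hu.1]) a) (rpow_nonneg (by linarith [hu.2]) b)
  have hQP : ∫ u in r..s, u ^ a * (t - u) ^ b ≤ ∫ u in r..s, u ^ a * (s - u) ^ b :=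
    intervalIntegral.integral_mono_on_of_le_Ioo hrs.le
      (intervalIntegrable_rpow_mul_sub_rpow_of_mem ha hb0 hr.le hrs.le hst.le ht) hintP
      fun u hu => mul_le_mul_of_nonneg_left (sub_rpow_le_sub_rpow hb1 hu.2 hst.le)
        (rpow_nonneg (by linarith [hu.1]) a)
  have hint0 := intervalIntegrable_rpow_mul_sub_rpow_of_mem ha hb0 le_rfl hr.le le_rfl hr
  have hintt := intervalIntegrable_rpow_mul_sub_rpow_of_mem ha hb0 le_rfl hr.le
    (hrs.trans hst).le ht
  have hS0 : 0 ≤ ∫ u in (0:ℝ)..r, u ^ a * ((r - u) ^ b - (t - u) ^ b) := by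
    have h := intervalIntegral.integral_mono_on_of_le_Ioo hr.le hintt hint0
      fun u hu => mul_le_mul_of_nonneg_left (sub_rpow_le_sub_rpow hb1 hu.2 (hrs.trans hst).le)
        (rpow_nonneg hu.1.le a)
    simp only [mul_sub]
    rw [intervalIntegral.integral_sub hint0 hintt]
    linarith
  have hmain : 2 * (∫ u in r..s, u ^ a * (s - u) ^ b)
      + (∫ u in (0:ℝ)..r, u ^ a * ((r - u) ^ b - (t - u) ^ b))
      ≤ L * ((t - r) ^ (1 + b) * s ^ a) := by
    rcases le_total s (2 * r) with hsr | hsr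
    · have hP := integral_rpow_mul_sub_rpow_le ha hb0 hs (by linarith) hrs.le le_rfl
      have hS := integral_rpow_mul_sub_rpow_sub_le ha hb0 hb1 hr hsr hrs hst
      have hdmono : (s - r) ^ (1 + b) ≤ (t - r) ^ (1 + b) :=
        rpow_le_rpow (by linarith) (by linarith) hb'.le
      have hP' : K / (1 + b) * (s - r) ^ (1 + b) * s ^ a
          ≤ K / (1 + b) * (t - r) ^ (1 + b) * s ^ a := by gcongr
      have h0 : 0 ≤ 3 * B * 2 ^ (1 + b) * ((t - r) ^ (1 + b) * s ^ a) := by positivity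
      rw [← hK] at hP hS
      calc _ ≤ 3 * B * 2 ^ (1 + b) * ((t - r) ^ (1 + b) * s ^ a)
            + (2 * (K / (1 + b) * (t - r) ^ (1 + b) * s ^ a)
            + (K / (1 + b) + 2 * K / (1 + a)) * (t - r) ^ (1 + b) * s ^ a) := by linarith
        _ = _ := by rw [hL]; ring
    · have hspow : s ^ (1 + b) ≤ 2 ^ (1 + b) * (t - r) ^ (1 + b) := by
        rw [← mul_rpow (by norm_num) hd.le]
        exact rpow_le_rpow hs.le (by linarith) hb'.le
      have hP : ∫ u in r..s, u ^ a * (s - u) ^ b ≤ B * s ^ (1 + b) * s ^ a := by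
        rw [hB, ← integral_rpow_mul_sub_rpow a b hs,
          ← intervalIntegral.integral_add_adjacent_intervals
            (intervalIntegrable_rpow_mul_sub_rpow_of_mem ha hb0 le_rfl hr.le hrs.le hs) hintP]
        have : 0 ≤ ∫ u in (0:ℝ)..r, u ^ a * (s - u) ^ b :=
          intervalIntegral.integral_nonneg hr.le fun u hu =>
            mul_nonneg (rpow_nonneg hu.1 a) (rpow_nonneg (by linarith [hu.2]) b)
        linarith
      have hS : ∫ u in (0:ℝ)..r, u ^ a * ((r - u) ^ b - (t - u) ^ b)
          ≤ B * s ^ (1 + b) * s ^ a := by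
        have h1 : r ^ (1 + b) * r ^ a ≤ s ^ (1 + b) * s ^ a := by
          rw [← rpow_add hr, ← rpow_add hs]
          exact rpow_le_rpow hr.le hrs.le (by linarith [neg_abs_le b])
        have h2 := integral_rpow_mul_sub_rpow a b hr
        have h3 : 0 ≤ ∫ u in (0:ℝ)..r, u ^ a * (t - u) ^ b :=
          intervalIntegral.integral_nonneg hr.le fun u hu =>
            mul_nonneg (rpow_nonneg hu.1 a) (rpow_nonneg (by linarith [hu.2]) b)
        have h4 := mul_le_mul_of_nonneg_left h1 hB0
        simp only [mul_sub]
        rw [intervalIntegral.integral_sub hint0 hintt]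
        linarith
      calc _ ≤ 3 * B * s ^ (1 + b) * s ^ a := by linarith
        _ ≤ 3 * B * (2 ^ (1 + b) * (t - r) ^ (1 + b)) * s ^ a := by gcongr
        _ = 3 * B * 2 ^ (1 + b) * ((t - r) ^ (1 + b) * s ^ a) := by ring
        _ ≤ _ := by
          gcongr
          rw [hL, le_add_iff_nonneg_right]
          positivity
  rw [R_sub_R_eq ha hb0 hr hrs hst, abs_mul, ← hc]
  calc _ ≤ |c| * (L * ((t - r) ^ (1 + b) * s ^ a)) := by
        gcongr
        rw [abs_le]
        constructor <;> linarith
    _ ≤ (|c| * L + 1) * (t - r) ^ (1 + b) * s ^ a := by linarith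
end

section
/- Let a, b be real numbers with a > -1, |b| < 1 and |b| < 1 + a, let s, r > 0 with s ≠ r, set μ = R_{a,b}(s,r) and ρ² = (sr)^{1+a+b} - μ², and let φ_{s,r} and p_τ be as in the context. Then for every twice continuously differentiable function f: ℝ → ℝ with compact support: |∫_{ℝ²} f''(x) f(y) φ_{s,r}(x,y) dx dy| ≤ (r^{1+a+b}/ρ²) · (∫_ℝ f(x)² p_s(x) dx + ∫_ℝ f(x)² p_r(x) dx). -/
open Real MeasureTheory

/-- The joint Gaussian density of `(B^{a,b}_s, B^{a,b}_r)`. -/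
noncomputable def phi (a b s r : ℝ) (x y : ℝ) : ℝ :=
  (1 / (2 * Real.pi * Real.sqrt ((s * r) ^ (1 + a + b) - (R a b s r) ^ 2))) *
    Real.exp (-(1 / (2 * ((s * r) ^ (1 + a + b) - (R a b s r) ^ 2))) *
      (r ^ (1 + a + b) * x ^ 2 - 2 * R a b s r * x * y + s ^ (1 + a + b) * y ^ 2))

/-- The marginal Gaussian density of `B^{a,b}_τ`. -/
noncomputable def p (a b τ : ℝ) (x : ℝ) : ℝ :=
  (2 * Real.pi * τ ^ (1 + a + b)) ^ (-(1:ℝ) / 2) * Real.exp (-(x ^ 2) / (2 * τ ^ (1 + a + b)))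


theorem integral_rpow_mul_sub_rpow_s12 {u v s : ℝ} (hu : 0 < u) (hv : 0 < v) (hs : 0 < s) :
    ∫ x in (0 : ℝ)..s, x ^ (u - 1) * (s - x) ^ (v - 1) = s ^ (u + v - 1) * Beta u v := by
  have h := Complex.betaIntegral_scaled u v hs
  rw [Complex.betaIntegral_eq_Gamma_mul_div _ _ (by simpa) (by simpa)] at h
  have hcongr : ∫ x in (0 : ℝ)..s, (x : ℂ) ^ ((u : ℂ) - 1) * ((s : ℂ) - x) ^ ((v : ℂ) - 1) =
      ∫ x in (0 : ℝ)..s, ((x ^ (u - 1) * (s - x) ^ (v - 1) : ℝ) : ℂ) := by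
    refine intervalIntegral.integral_congr fun x hx => ?_
    rw [Set.uIcc_of_le hs.le] at hx
    rw [Complex.ofReal_mul, Complex.ofReal_cpow hx.1, Complex.ofReal_cpow (sub_nonneg.2 hx.2)]
    push_cast
    rfl
  rw [hcongr, intervalIntegral.integral_ofReal] at h
  have h2 : (s : ℂ) ^ ((u : ℂ) + v - 1) = ((s ^ (u + v - 1) : ℝ) : ℂ) := by
    rw [Complex.ofReal_cpow hs.le]
    push_cast
    rfl
  rw [h2, ← Complex.ofReal_add, Complex.Gamma_ofReal, Complex.Gamma_ofReal,
    Complex.Gamma_ofReal] at h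
  rw [Beta]
  exact_mod_cast h

theorem Beta_pos {u v : ℝ} (hu : 0 < u) (hv : 0 < v) : 0 < Beta u v :=
  ProbabilityTheory.beta_pos hu hv

theorem intervalIntegrable_rpow_mul_sub_rpow_s12 {u v s : ℝ} (hu : 0 < u) (hv : 0 < v) (hs : 0 < s) :
    IntervalIntegrable (fun x => x ^ (u - 1) * (s - x) ^ (v - 1)) volume 0 s := by
  refine intervalIntegral.intervalIntegrable_of_integral_ne_zero ?_
  rw [integral_rpow_mul_sub_rpow_s12 hu hv hs]
  exact (mul_pos (rpow_pos_of_pos hs _) (Beta_pos hu hv)).ne'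

theorem mul_Beta_eq {u v : ℝ} (hu : 0 < u) (hv : 0 < v) :
    v * Beta u v = (u + v) * Beta u (v + 1) := by
  have h1 : Real.Gamma (u + v) ≠ 0 := (Real.Gamma_pos_of_pos (add_pos hu hv)).ne'
  have h2 : u + v ≠ 0 := (add_pos hu hv).ne'
  rw [Beta, Beta, Real.Gamma_add_one hv.ne', ← add_assoc, Real.Gamma_add_one h2]
  field_simp

theorem rpow_sub_one_le_div_mul_rpow_sub_one {x b k : ℝ} (hx : 0 ≤ x) (hb : 0 < b) (hbk : b ≤ k) :
    x ^ b - 1 ≤ b / k * (x ^ k - 1) := by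
  have hk : 0 < k := hb.trans_le hbk
  have h := one_add_mul_self_le_rpow_one_add (s := x ^ b - 1)
    (by linarith [rpow_nonneg hx b]) ((one_le_div hb).2 hbk)
  rw [add_sub_cancel, ← rpow_mul hx, mul_div_cancel₀ _ hb.ne'] at h
  have h3 : b / k * (k / b * (x ^ b - 1)) ≤ b / k * (x ^ k - 1) := by
    gcongr
    linarith
  calc x ^ b - 1 = b / k * (k / b * (x ^ b - 1)) := by field_simp
    _ ≤ _ := h3

theorem sub_rpow_le {b k s r u : ℝ} (hb : 0 < b) (hb1 : b ≤ 1) (hbk : b ≤ k)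
    (hu : 0 < u) (hus : u < s) (hsr : s < r) :
    (r - u) ^ b ≤ (s - u) ^ b + b / k * ((r / s) ^ k - 1) * s * (s - u) ^ (b - 1) := by
  have hs : 0 < s := hu.trans hus
  have hsu : 0 < s - u := sub_pos.2 hus
  have hru : 0 < r - u := by linarith
  have hconc := (Real.concaveOn_rpow hb.le hb1).2
    (show (r - u) / (s - u) ∈ Set.Ici 0 from (div_pos hru hsu).le)
    (Set.mem_Ici.2 zero_le_one)
    (show 0 ≤ (s - u) / s by positivity) (show 0 ≤ u / s by positivity) (by field_simp; ring)
  simp only [smul_eq_mul, one_rpow, mul_one] at hconc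
  have e : (s - u) / s * ((r - u) / (s - u)) + u / s = r / s := by field_simp; ring
  rw [e, div_rpow hru.le hsu.le] at hconc
  have hB := rpow_sub_one_le_div_mul_rpow_sub_one (x := r / s)
    (div_pos (hs.trans hsr) hs).le hb hbk
  have hP : 0 < (s - u) ^ b := rpow_pos_of_pos hsu b
  rw [rpow_sub_one hsu.ne']
  have key : (s - u) / s * ((r - u) ^ b / (s - u) ^ b) ≤
      b / k * ((r / s) ^ k - 1) + (s - u) / s := by
    have : u / s = 1 - (s - u) / s := by field_simp; ring
    linarith
  have h2 := mul_le_mul_of_nonneg_left key (show 0 ≤ s / (s - u) * (s - u) ^ b by positivity)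
  calc (r - u) ^ b = s / (s - u) * (s - u) ^ b * ((s - u) / s * ((r - u) ^ b / (s - u) ^ b)) := by
        field_simp
    _ ≤ _ := h2
    _ = _ := by field_simp; ring

theorem integral_rpow_mul_add_rpow_le {a b s r : ℝ} (ha : -1 < a) (hb1 : |b| < 1)
    (hb2 : |b| < 1 + a) (hs : 0 < s) (hsr : s < r) :
    ∫ u in (0 : ℝ)..s, u ^ a * ((s - u) ^ b + (r - u) ^ b) ≤
      2 * Beta (a + 1) (b + 1) * (s * r) ^ ((1 + a + b) / 2) := by
  have hr : 0 < r := hs.trans hsr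
  obtain ⟨hbl, hbr⟩ := abs_lt.1 hb1
  obtain ⟨hbl', hbr'⟩ := abs_lt.1 hb2
  have ha1 : 0 < a + 1 := by linarith
  have hb0 : 0 < b + 1 := by linarith
  have hk : 0 < (1 + a + b) / 2 := by linarith
  have hB := Beta_pos ha1 hb0
  have hI := integral_rpow_mul_sub_rpow_s12 ha1 hb0 hs
  have hII := intervalIntegrable_rpow_mul_sub_rpow_s12 ha1 hb0 hs
  have hexp : s ^ (a + 1 + (b + 1) - 1) = s ^ ((1 + a + b) / 2) * s ^ ((1 + a + b) / 2) := by
    rw [← rpow_add hs]; ring_nf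
  simp only [add_sub_cancel_right] at hI hII
  rw [hexp] at hI
  have hcompare : ∀ G : ℝ → ℝ, IntervalIntegrable G volume 0 s →
      (∀ u ∈ Set.Ioo 0 s, u ^ a * ((s - u) ^ b + (r - u) ^ b) ≤ G u) →
      ∫ u in (0 : ℝ)..s, u ^ a * ((s - u) ^ b + (r - u) ^ b) ≤ ∫ u in (0 : ℝ)..s, G u := by
    intro G hG hle
    rw [intervalIntegral.integral_of_le hs.le, intervalIntegral.integral_of_le hs.le,
      integral_Ioc_eq_integral_Ioo, integral_Ioc_eq_integral_Ioo]
    refine integral_mono_of_nonneg ?_ ?_ ?_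
    · refine (ae_restrict_mem measurableSet_Ioo).mono fun u hu => ?_
      have h1 : 0 ≤ s - u := by linarith [hu.2]
      have h2 : 0 ≤ r - u := by linarith [hu.2]
      have h3 : 0 ≤ u := hu.1.le
      show (0 : ℝ) ≤ _
      positivity
    · exact ((intervalIntegrable_iff_integrableOn_Ioc_of_le hs.le).1 hG).mono_set
        Set.Ioo_subset_Ioc_self
    · exact (ae_restrict_mem measurableSet_Ioo).mono fun u hu => hle u hu
  rw [mul_rpow hs.le hr.le]
  rcases le_or_gt b 0 with hb | hb
  · refine (hcompare (fun u => 2 * (u ^ a * (s - u) ^ b)) (hII.const_mul 2) fun u hu => ?_).trans ?_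
    · have h1 : 0 < s - u := by linarith [hu.2]
      have h2 : (r - u) ^ b ≤ (s - u) ^ b := rpow_le_rpow_of_nonpos h1 (by linarith) hb
      nlinarith [rpow_nonneg hu.1.le a]
    · rw [intervalIntegral.integral_const_mul, hI]
      have : s ^ ((1 + a + b) / 2) ≤ r ^ ((1 + a + b) / 2) := rpow_le_rpow hs.le hsr.le hk.le
      calc _ = 2 * Beta (a + 1) (b + 1) * (s ^ ((1 + a + b) / 2) * s ^ ((1 + a + b) / 2)) := by ring
        _ ≤ _ := by gcongr
  · have hJ := integral_rpow_mul_sub_rpow_s12 ha1 hb hs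
    have hJI := intervalIntegrable_rpow_mul_sub_rpow_s12 ha1 hb hs
    simp only [add_sub_cancel_right] at hJ hJI
    set k := (1 + a + b) / 2 with hkdef
    set C := b / k * ((r / s) ^ k - 1) * s with hC
    refine (hcompare (fun u => 2 * (u ^ a * (s - u) ^ b) + C * (u ^ a * (s - u) ^ (b - 1)))
      ((hII.const_mul 2).add (hJI.const_mul C)) fun u hu => ?_).trans ?_
    · have h := sub_rpow_le (k := k) hb hbr.le (by linarith) hu.1 hu.2 hsr
      nlinarith [rpow_nonneg hu.1.le a]
    · rw [intervalIntegral.integral_add (hII.const_mul 2) (hJI.const_mul C),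
        intervalIntegral.integral_const_mul, intervalIntegral.integral_const_mul, hI, hJ]
      have h1 : s * s ^ (a + 1 + b - 1) = s ^ k * s ^ k := by
        rw [← rpow_add hs, ← rpow_one_add' hs.le (by linarith)]
        congr 1
        rw [hkdef]
        ring
      have h2 : b * Beta (a + 1) b = 2 * k * Beta (a + 1) (b + 1) := by
        rw [mul_Beta_eq ha1 hb, hkdef]
        ring
      refine le_of_eq ?_
      calc _ = 2 * (s ^ k * s ^ k * Beta (a + 1) (b + 1)) + (b * Beta (a + 1) b) / k *
            ((r / s) ^ k - 1) * (s * s ^ (a + 1 + b - 1)) := by rw [hC]; ring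
        _ = 2 * Beta (a + 1) (b + 1) * (s ^ k * s ^ k) * (r / s) ^ k := by
          rw [h1, h2]; field_simp; ring
        _ = _ := by
          rw [div_rpow hr.le hs.le]
          have := (rpow_pos_of_pos hs k).ne'
          field_simp

theorem R_comm (a b s r : ℝ) : R a b s r = R a b r s := by
  simp only [R, min_comm s r, add_comm]

theorem R_sq_le {a b s r : ℝ} (ha : -1 < a) (hb1 : |b| < 1) (hb2 : |b| < 1 + a)
    (hs : 0 < s) (hr : 0 < r) (hsr : s ≠ r) : R a b s r ^ 2 ≤ (s * r) ^ (1 + a + b) := by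
  wlog h : s < r generalizing s r
  · rw [R_comm, mul_comm s r]
    exact this hr hs hsr.symm (lt_of_le_of_ne (not_lt.1 h) hsr.symm)
  have hB : 0 < Beta (a + 1) (b + 1) :=
    Beta_pos (by linarith) (by linarith [(abs_lt.1 hb1).1])
  have h0 : 0 ≤ R a b s r := by
    rw [R, min_eq_left h.le]
    refine mul_nonneg (by positivity) (intervalIntegral.integral_nonneg hs.le fun u hu => ?_)
    have h1 : 0 ≤ s - u := by linarith [hu.2]
    have h2 : 0 ≤ r - u := by linarith [hu.2]
    have h3 : 0 ≤ u := hu.1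
    positivity
  have hle : R a b s r ≤ (s * r) ^ ((1 + a + b) / 2) := by
    rw [R, min_eq_left h.le, one_div, inv_mul_le_iff₀ (by positivity)]
    exact integral_rpow_mul_add_rpow_le ha hb1 hb2 hs h
  calc R a b s r ^ 2 ≤ ((s * r) ^ ((1 + a + b) / 2)) ^ 2 := by gcongr
    _ = _ := by
      rw [← rpow_natCast, ← rpow_mul (mul_pos hs hr).le]
      norm_num

/-- The density of the centred Gaussian distribution of variance `V`. -/
noncomputable def gauss (V x : ℝ) : ℝ := (√(2 * π * V))⁻¹ * exp (-(2 * V)⁻¹ * x ^ 2)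

theorem gauss_pos {V : ℝ} (hV : 0 < V) (x : ℝ) : 0 < gauss V x := by
  rw [gauss]; positivity

@[fun_prop]
theorem continuous_gauss (V : ℝ) : Continuous (gauss V) := by
  unfold gauss; fun_prop

theorem hasDerivAt_gauss (V x : ℝ) : HasDerivAt (gauss V) (-(x / V) * gauss V x) x := by
  have h := (((hasDerivAt_pow 2 x).const_mul (-(2 * V)⁻¹)).exp).const_mul (√(2 * π * V))⁻¹
  refine h.congr_deriv ?_
  rw [gauss]
  field_simp
  norm_num

theorem integrable_pow_mul_gauss {V : ℝ} (hV : 0 < V) (n : ℕ) :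
    Integrable fun x => x ^ n * gauss V x := by
  have h := (integrable_rpow_mul_exp_neg_mul_sq (b := (2 * V)⁻¹) (by positivity)
    (s := n) (by linarith [n.cast_nonneg (α := ℝ)])).const_mul (√(2 * π * V))⁻¹
  refine h.congr (ae_of_all _ fun x => ?_)
  simp only [gauss, rpow_natCast]
  ring

theorem integrable_gauss {V : ℝ} (hV : 0 < V) : Integrable (gauss V) := by
  simpa using integrable_pow_mul_gauss hV 0

theorem integral_gauss {V : ℝ} (hV : 0 < V) : ∫ x, gauss V x = 1 := by
  simp only [gauss]
  rw [integral_const_mul, integral_gaussian]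
  have : π / (2 * V)⁻¹ = 2 * π * V := by field_simp
  rw [this, inv_mul_cancel₀]
  positivity

theorem integrable_hermite_sq_mul_gauss {V : ℝ} (hV : 0 < V) :
    Integrable fun x => (x ^ 2 / V ^ 2 - 1 / V) ^ 2 * gauss V x := by
  refine ((((integrable_pow_mul_gauss hV 4).div_const (V ^ 4)).sub
    ((integrable_pow_mul_gauss hV 2).const_mul (2 / V ^ 3))).add
    ((integrable_gauss hV).div_const (V ^ 2))).congr (ae_of_all _ fun x => ?_)
  simp only [Pi.add_apply, Pi.sub_apply]
  field_simp
  ring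

theorem integral_hermite_sq_mul_gauss {V : ℝ} (hV : 0 < V) :
    ∫ x, (x ^ 2 / V ^ 2 - 1 / V) ^ 2 * gauss V x = 2 / V ^ 2 := by
  have hi := integrable_hermite_sq_mul_gauss hV
  have h0 := integral_eq_zero_of_hasDerivAt_of_integrable
    (f := fun x => (-(x ^ 3 / V ^ 3) - x / V ^ 2) * gauss V x)
    (f' := fun x => (x ^ 2 / V ^ 2 - 1 / V) ^ 2 * gauss V x - 2 / V ^ 2 * gauss V x)
    (fun x => by
      refine (((((hasDerivAt_pow 3 x).div_const (V ^ 3)).neg).sub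
        ((hasDerivAt_id x).div_const (V ^ 2))).mul (hasDerivAt_gauss V x)).congr_deriv ?_
      simp only [Pi.sub_apply, Pi.neg_apply, id]
      field_simp
      ring)
    (hi.sub ((integrable_gauss hV).const_mul _))
    (by
      refine ((((integrable_pow_mul_gauss hV 3).div_const (V ^ 3)).neg).sub
        ((integrable_pow_mul_gauss hV 1).div_const (V ^ 2))).congr (ae_of_all _ fun x => ?_)
      simp only [Pi.neg_apply, Pi.sub_apply]
      ring)
  rw [integral_sub hi ((integrable_gauss hV).const_mul _), integral_const_mul,
    integral_gauss hV] at h0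
  linarith

theorem integral_deriv_deriv_mul_gauss {V : ℝ} (hV : 0 < V) (c : ℝ) {f : ℝ → ℝ}
    (hf : ContDiff ℝ 2 f) (hsupp : HasCompactSupport f) :
    ∫ x, deriv (deriv f) x * gauss V (x - c) =
      ∫ x, f x * (((x - c) ^ 2 / V ^ 2 - 1 / V) * gauss V (x - c)) := by
  have hf1 : ContDiff ℝ 1 (deriv f) := hf.deriv' (n := 1)
  have hc0 := hf.continuous
  have hc1 := hf1.continuous
  have hc2 : Continuous (deriv (deriv f)) := hf1.continuous_deriv le_rfl
  have hd0 (x : ℝ) : HasDerivAt f (deriv f x) x :=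
    (hf.differentiable (by norm_num) x).hasDerivAt
  have hd1 (x : ℝ) : HasDerivAt (deriv f) (deriv (deriv f) x) x :=
    (hf1.differentiable (by norm_num) x).hasDerivAt
  have hg (x : ℝ) : HasDerivAt (fun x => gauss V (x - c))
      (-((x - c) / V) * gauss V (x - c)) x :=
    (hasDerivAt_gauss V (x - c)).comp_sub_const x c
  have hg2 (x : ℝ) : HasDerivAt (fun x => -((x - c) / V) * gauss V (x - c))
      (((x - c) ^ 2 / V ^ 2 - 1 / V) * gauss V (x - c)) x := by
    refine (((((hasDerivAt_id x).sub_const c).div_const V).neg).mul (hg x)).congr_deriv ?_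
    simp only [Pi.neg_apply, id]
    field_simp
    ring
  have hint {u v : ℝ → ℝ} (hu : Continuous u) (hs : HasCompactSupport u) (hv : Continuous v) :
      Integrable (u * v) :=
    (hu.mul hv).integrable_of_hasCompactSupport hs.mul_right
  have e1 := integral_mul_deriv_eq_deriv_mul_of_integrable (u := deriv f)
    (fun x _ => hd1 x) (fun x _ => hg x)
    (hint hc1 hsupp.deriv (by fun_prop)) (hint hc2 hsupp.deriv.deriv (by fun_prop))
    (hint hc1 hsupp.deriv (by fun_prop))
  have e2 := integral_mul_deriv_eq_deriv_mul_of_integrable (u := f)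
    (fun x _ => hd0 x) (fun x _ => hg2 x)
    (hint hc0 hsupp (by fun_prop)) (hint hc1 hsupp.deriv (by fun_prop))
    (hint hc0 hsupp (by fun_prop))
  linarith

theorem abs_integral_deriv_deriv_mul_le {A B V W m n : ℝ} (hA : 0 < A) (hB : 0 < B) (hV : 0 < V)
    (hW : 0 < W) {φ : ℝ → ℝ → ℝ}
    (h₁ : ∀ x y, φ x y = gauss B y * gauss V (x - m * y))
    (h₂ : ∀ x y, φ x y = gauss A x * gauss W (y - n * x))
    {f : ℝ → ℝ} (hf : ContDiff ℝ 2 f) (hsupp : HasCompactSupport f) :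
    |∫ q : ℝ × ℝ, deriv (deriv f) q.1 * f q.2 * φ q.1 q.2| ≤
      1 / V * ((∫ x, f x ^ 2 * gauss A x) + ∫ x, f x ^ 2 * gauss B x) := by
  have hc0 := hf.continuous
  have hc2 : Continuous (deriv (deriv f)) :=
    (hf.deriv' (n := 1)).continuous_deriv le_rfl
  have hs2 : HasCompactSupport fun x => f x ^ 2 := hsupp.comp_left (g := fun t => t ^ 2) (by simp)
  have hφc : Continuous fun q : ℝ × ℝ => φ q.1 q.2 := by
    simp only [h₁]; fun_prop
  have hφ0 (x y : ℝ) : 0 ≤ φ x y := by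
    rw [h₁]; exact (mul_pos (gauss_pos hB _) (gauss_pos hV _)).le
  let K : ℝ → ℝ := fun z => z ^ 2 / V ^ 2 - 1 / V
  have hKc : Continuous K := by fun_prop
  have hX : ∀ x, (∫ y, f x ^ 2 * φ x y) = f x ^ 2 * gauss A x := by
    intro x
    simp only [h₂]
    rw [integral_const_mul, integral_const_mul, integral_sub_right_eq_self (gauss W),
      integral_gauss hW, mul_one]
  have hY : ∀ y, (∫ x, f y ^ 2 * K (x - m * y) ^ 2 * φ x y) =
      2 / V ^ 2 * (f y ^ 2 * gauss B y) := by
    intro y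
    have e : ∀ x, f y ^ 2 * K (x - m * y) ^ 2 * φ x y =
        (f y ^ 2 * gauss B y) * (K (x - m * y) ^ 2 * gauss V (x - m * y)) := by
      intro x; rw [h₁]; ring
    simp only [e]
    rw [integral_const_mul, integral_sub_right_eq_self (fun z => K z ^ 2 * gauss V z),
      integral_hermite_sq_mul_gauss hV, mul_comm]
  have hXi : Integrable (fun q : ℝ × ℝ => f q.1 ^ 2 * φ q.1 q.2) (volume.prod volume) := by
    rw [integrable_prod_iff (by fun_prop)]
    refine ⟨ae_of_all _ fun x => ?_, ?_⟩
    · simp only [h₂]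
      exact (((integrable_gauss hW).comp_sub_right _).const_mul _).const_mul _
    · simp only [norm_of_nonneg (mul_nonneg (sq_nonneg (f _)) (hφ0 _ _)), hX]
      exact (Continuous.mul (by fun_prop) (by fun_prop)).integrable_of_hasCompactSupport
        hs2.mul_right
  have hYi : Integrable (fun q : ℝ × ℝ => f q.2 ^ 2 * K (q.1 - m * q.2) ^ 2 * φ q.1 q.2)
      (volume.prod volume) := by
    rw [integrable_prod_iff' (by fun_prop)]
    refine ⟨ae_of_all _ fun y => ?_, ?_⟩
    · refine (((integrable_hermite_sq_mul_gauss hV).comp_sub_right (m * y)).const_mul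
        (f y ^ 2 * gauss B y)).congr (ae_of_all _ fun x => ?_)
      simp only [h₁, K]
      ring
    · simp only [norm_of_nonneg
        (mul_nonneg (mul_nonneg (sq_nonneg (f _)) (sq_nonneg (K _))) (hφ0 _ _)), hY]
      exact ((Continuous.mul (by fun_prop) (by fun_prop)).integrable_of_hasCompactSupport
        hs2.mul_right).const_mul _
  have hGi := (hXi.const_mul (1 / (2 * V))).add (hYi.const_mul (V / 2))
  have hbound : ∀ q : ℝ × ℝ, ‖f q.1 * f q.2 * K (q.1 - m * q.2) * φ q.1 q.2‖ ≤
      1 / (2 * V) * (f q.1 ^ 2 * φ q.1 q.2) +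
        V / 2 * (f q.2 ^ 2 * K (q.1 - m * q.2) ^ 2 * φ q.1 q.2) := by
    rintro ⟨x, y⟩
    simp only
    rw [norm_mul, norm_of_nonneg (hφ0 x y), norm_eq_abs]
    have : |f x * f y * K (x - m * y)| ≤
        1 / (2 * V) * f x ^ 2 + V / 2 * (f y ^ 2 * K (x - m * y) ^ 2) := by
      generalize K (x - m * y) = k
      have h1 : 0 ≤ (f x - V * (f y * k)) ^ 2 / (2 * V) := by positivity
      have h2 : 0 ≤ (f x + V * (f y * k)) ^ 2 / (2 * V) := by positivity
      have e1 : (f x - V * (f y * k)) ^ 2 / (2 * V) =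
        1 / (2 * V) * f x ^ 2 + V / 2 * (f y ^ 2 * k ^ 2) - f x * f y * k := by field_simp; ring
      have e2 : (f x + V * (f y * k)) ^ 2 / (2 * V) =
        1 / (2 * V) * f x ^ 2 + V / 2 * (f y ^ 2 * k ^ 2) + f x * f y * k := by field_simp; ring
      exact abs_le.2 ⟨by linarith, by linarith⟩
    calc _ ≤ _ := mul_le_mul_of_nonneg_right this (hφ0 x y)
      _ = _ := by ring
  have hFi : Integrable (fun q : ℝ × ℝ => f q.1 * f q.2 * K (q.1 - m * q.2) * φ q.1 q.2)
      (volume.prod volume) :=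
    hGi.mono' (by fun_prop) (ae_of_all _ hbound)
  have hLi : Integrable (fun q : ℝ × ℝ => deriv (deriv f) q.1 * f q.2 * φ q.1 q.2)
      (volume.prod volume) := by
    refine Continuous.integrable_of_hasCompactSupport (by fun_prop) (HasCompactSupport.mul_right ?_)
    refine HasCompactSupport.intro (hsupp.deriv.deriv.isCompact.prod hsupp.isCompact) fun q hq => ?_
    by_contra h
    exact hq ⟨subset_tsupport _ (left_ne_zero_of_mul h), subset_tsupport _ (right_ne_zero_of_mul h)⟩
  have hparts : (∫ q : ℝ × ℝ, deriv (deriv f) q.1 * f q.2 * φ q.1 q.2) =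
      ∫ q : ℝ × ℝ, f q.1 * f q.2 * K (q.1 - m * q.2) * φ q.1 q.2 := by
    rw [Measure.volume_eq_prod, integral_prod_symm _ hLi, integral_prod_symm _ hFi]
    refine integral_congr_ae (ae_of_all _ fun y => ?_)
    have h := congrArg (fun t => f y * gauss B y * t)
      (integral_deriv_deriv_mul_gauss hV (m * y) hf hsupp)
    simp only [← integral_const_mul] at h
    refine Eq.trans (integral_congr_ae (ae_of_all _ fun x => ?_))
      (h.trans (integral_congr_ae (ae_of_all _ fun x => ?_)))
    · simp only [h₁]
      ring
    · simp only [h₁, K]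
      ring
  rw [hparts, ← norm_eq_abs]
  refine (norm_integral_le_of_norm_le hGi (ae_of_all _ hbound)).trans ?_
  simp only [Pi.add_apply]
  rw [integral_add (hXi.const_mul _) (hYi.const_mul _), integral_const_mul,
    integral_const_mul, integral_prod _ hXi, integral_prod_symm _ hYi]
  simp only [hX, hY]
  rw [integral_const_mul]
  have h0 : 0 ≤ 1 / (2 * V) * ∫ x, f x ^ 2 * gauss A x :=
    mul_nonneg (by positivity)
      (integral_nonneg fun x => mul_nonneg (sq_nonneg _) (gauss_pos hA x).le)
  refine (le_add_of_nonneg_left h0).trans (le_of_eq ?_)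
  field_simp
  ring

theorem gauss_mul_gauss_eq {A B μ : ℝ} (hB : 0 < B) (hD : 0 < A * B - μ ^ 2) (x y : ℝ) :
    gauss B y * gauss ((A * B - μ ^ 2) / B) (x - μ / B * y) =
      1 / (2 * π * √(A * B - μ ^ 2)) * exp (-(1 / (2 * (A * B - μ ^ 2))) *
        (B * x ^ 2 - 2 * μ * x * y + A * y ^ 2)) := by
  have hc : √(2 * π * B) * √(2 * π * ((A * B - μ ^ 2) / B)) = 2 * π * √(A * B - μ ^ 2) := by
    rw [← sqrt_mul (by positivity)]
    have : 2 * π * B * (2 * π * ((A * B - μ ^ 2) / B)) = (2 * π) ^ 2 * (A * B - μ ^ 2) := by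
      field_simp
    rw [this, sqrt_mul (by positivity), sqrt_sq (by positivity)]
  rw [gauss, gauss, mul_mul_mul_comm, ← mul_inv, hc, ← exp_add, one_div]
  congr 2
  have hD' := hD.ne'
  generalize hd : A * B - μ ^ 2 = D at *
  have hA : A = (D + μ ^ 2) / B := by field_simp; linarith
  rw [hA]
  field_simp
  ring

theorem p_eq_gauss (a b : ℝ) {τ : ℝ} (hτ : 0 < τ) : p a b τ = gauss (τ ^ (1 + a + b)) := by
  ext x
  rw [p, gauss, neg_div, rpow_neg (by positivity), ← sqrt_eq_rpow]
  congr 2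
  field_simp

theorem stmt_12 (a b : ℝ) (ha : -1 < a) (hb1 : |b| < 1) (hb2 : |b| < 1 + a)
    (s r : ℝ) (hs : 0 < s) (hr : 0 < r) (hsr : s ≠ r)
    (f : ℝ → ℝ) (hf : ContDiff ℝ 2 f) (hsupp : HasCompactSupport f) :
    |∫ q : ℝ × ℝ, deriv (deriv f) q.1 * f q.2 * phi a b s r q.1 q.2| ≤
      (r ^ (1 + a + b) / ((s * r) ^ (1 + a + b) - (R a b s r) ^ 2)) *
        ((∫ x : ℝ, f x ^ 2 * p a b s x) + ∫ x : ℝ, f x ^ 2 * p a b r x) := by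
  have hle := R_sq_le ha hb1 hb2 hs hr hsr
  rcases hle.eq_or_lt with h | h
  · simp [phi, h]
  have hD := sub_pos.2 h
  have hA : 0 < s ^ (1 + a + b) := rpow_pos_of_pos hs _
  have hB : 0 < r ^ (1 + a + b) := rpow_pos_of_pos hr _
  rw [p_eq_gauss a b hs, p_eq_gauss a b hr]
  have hmul := mul_rpow (z := 1 + a + b) hs.le hr.le
  rw [hmul] at hD ⊢
  rw [← one_div_div]
  refine abs_integral_deriv_deriv_mul_le (φ := phi a b s r) (m := R a b s r / r ^ (1 + a + b))
    (n := R a b s r / s ^ (1 + a + b)) (W := (s ^ (1 + a + b) * r ^ (1 + a + b) - R a b s r ^ 2) /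
      s ^ (1 + a + b)) hA hB (div_pos hD hB) (div_pos hD hA) (fun x y => ?_) (fun x y => ?_) hf hsupp
  · rw [gauss_mul_gauss_eq hB hD, phi, hmul]
  · rw [mul_comm (s ^ (1 + a + b))] at hD ⊢
    rw [gauss_mul_gauss_eq hA hD, phi, hmul, mul_comm (s ^ (1 + a + b))]
    congr 3
    ring
end
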